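/- arXiv:2010.16113 — 2 statements merged into one kernel-verified Lean document; each statement's English description precedes it below -/
import Mathlib

section
/- The collection of sets F(e;X), where e ranges over the idempotents E of S and X ranges over finite subsets of ↓e, forms a topological basis for the subspace topology that the patch topology induces on the set of idempotent proper filters of S (note that every filter containing an idempotent is idempotent, so each F(e;X) consists of idempotent proper filters). -/
/-- An inverse semigroup with zero: every element `a` has a unique `a⁻¹` with
`a * a⁻¹ * a = a` and `a⁻¹ * a * a⁻¹ = a⁻¹`, and `0` is absorbing. -/
class InvSemigroupWithZero (S : Type*) extends Semigroup S, Zero S, Inv S where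
  mul_inv_mul : ∀ a : S, a * a⁻¹ * a = a
  inv_mul_inv : ∀ a : S, a⁻¹ * a * a⁻¹ = a⁻¹
  inv_unique : ∀ a b : S, a * b * a = a → b * a * b = b → b = a⁻¹
  zero_mul : ∀ a : S, 0 * a = 0
  mul_zero : ∀ a : S, a * 0 = 0

namespace InvSemigroupWithZero

variable {S : Type*} [InvSemigroupWithZero S]

/-- The natural partial order on `S`: `a ≤ b` iff `a = a * a⁻¹ * b`. -/
def sle (a b : S) : Prop := a = a * a⁻¹ * b

/-- `↓s`, the down-set of `s` w.r.t. the natural partial order. -/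
def dwn (s : S) : Set S := {t : S | sle t s}

/-- `↑A`, the up-set generated by `A` w.r.t. the natural partial order. -/
def up (A : Set S) : Set S := {b : S | ∃ a ∈ A, sle a b}

/-- A filter in `S`: a nonempty down-directed up-set. -/
def IsFilt (F : Set S) : Prop :=
  F.Nonempty ∧ up F = F ∧ ∀ a ∈ F, ∀ b ∈ F, ∃ c ∈ F, sle c a ∧ sle c b

/-- A proper filter: a filter not containing `0`. -/
def IsPFilt (F : Set S) : Prop := IsFilt F ∧ (0 : S) ∉ F

/-- An ultrafilter: a proper filter maximal among proper filters. -/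
def IsUltra (U : Set S) : Prop :=
  IsPFilt U ∧ ∀ G : Set S, IsPFilt G → U ⊆ G → U = G

/-- The set `E` of idempotents of `S`. -/
def E (S : Type*) [InvSemigroupWithZero S] : Set S := {e : S | e * e = e}

/-- `F⁻¹ = {a⁻¹ : a ∈ F}`. -/
def finv (F : Set S) : Set S := (fun a : S => a⁻¹) '' F

/-- `F · G = ↑{fg : f ∈ F, g ∈ G}`. -/
def fmul (F G : Set S) : Set S := up (Set.image2 (· * ·) F G)

/-- The source `d(F) := F⁻¹ · F`. -/
def src (F : Set S) : Set S := fmul (finv F) F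

/-- The range `r(F) := F · F⁻¹`. -/
def rng (F : Set S) : Set S := fmul F (finv F)

/-- The natural partial order on the idempotents: `e ≤ f` iff `e = e * f`. -/
def ele (e f : S) : Prop := e = e * f

/-- The down-set of an idempotent `e` inside `E`. -/
def edwn (e : S) : Set S := {f : S | f ∈ E S ∧ ele f e}

/-- The up-set generated by `A` inside `E`. -/
def eup (A : Set S) : Set S := {f : S | f ∈ E S ∧ ∃ a ∈ A, ele a f}

/-- An `E`-filter: a proper filter of the inverse semigroup `E` of idempotents. -/
def IsEFilt (ξ : Set S) : Prop :=
  ξ ⊆ E S ∧ ξ.Nonempty ∧ eup ξ = ξ ∧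
    (∀ a ∈ ξ, ∀ b ∈ ξ, ∃ c ∈ ξ, ele c a ∧ ele c b) ∧ (0 : S) ∉ ξ

/-- An `E`-ultrafilter: an `E`-filter maximal among `E`-filters. -/
def IsEUltra (ξ : Set S) : Prop :=
  IsEFilt ξ ∧ ∀ η : Set S, IsEFilt η → ξ ⊆ η → ξ = η

/-- `β_s(ξ) = {f ∈ E : s·e·s⁻¹ ≤ f for some e ∈ ξ}`. -/
def beta (s : S) (ξ : Set S) : Set S :=
  {f : S | f ∈ E S ∧ ∃ e ∈ ξ, sle (s * e * s⁻¹) f}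

/-- The set of proper filters in `S`. -/
abbrev PFilt (S : Type*) [InvSemigroupWithZero S] := {F : Set S // IsPFilt F}

/-- The patch topology on the set of proper filters, generated by the sets
`F(s;T) = {F : s ∈ F, F ∩ T = ∅}` for `s ∈ S` and finite `T ⊆ ↓s`. -/
instance patchTopology : TopologicalSpace (PFilt S) :=
  TopologicalSpace.generateFrom
    {O : Set (PFilt S) | ∃ (s : S) (T : Set S), T.Finite ∧ T ⊆ dwn s ∧
      O = {F : PFilt S | s ∈ F.1 ∧ F.1 ∩ T = ∅}}

/-- The set of idempotent proper filters in `S`. -/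
abbrev IPFilt (S : Type*) [InvSemigroupWithZero S] :=
  {F : Set S // IsPFilt F ∧ (F ∩ E S).Nonempty}

/-- The subspace topology induced by the patch topology on proper filters. -/
instance : TopologicalSpace (IPFilt S) :=
  TopologicalSpace.induced (fun F => (⟨F.1, F.2.1⟩ : PFilt S)) inferInstance

/-- The set of `E`-filters. -/
abbrev EFilt (S : Type*) [InvSemigroupWithZero S] := {ξ : Set S // IsEFilt ξ}

/-- The patch topology on the set of `E`-filters, generated by the sets
`P(e;X) = {ξ : e ∈ ξ, ξ ∩ X = ∅}` for `e ∈ E` and finite `X ⊆ ↓e ∩ E`. -/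
instance : TopologicalSpace (EFilt S) :=
  TopologicalSpace.generateFrom
    {O : Set (EFilt S) | ∃ (e : S) (X : Set S), e ∈ E S ∧ X.Finite ∧ X ⊆ edwn e ∧
      O = {ξ : EFilt S | e ∈ ξ.1 ∧ ξ.1 ∩ X = ∅}}

/-- The set of ultrafilters in `S`. -/
abbrev UFilt (S : Type*) [InvSemigroupWithZero S] := {U : Set S // IsUltra U}

/-- The subspace topology induced by the patch topology on proper filters. -/
instance : TopologicalSpace (UFilt S) :=
  TopologicalSpace.induced (fun U => (⟨U.1, U.2.1⟩ : PFilt S)) inferInstance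

end InvSemigroupWithZero

open InvSemigroupWithZero

namespace InvSemigroupWithZero

variable {S : Type*} [InvSemigroupWithZero S]

theorem inv_eq_self_of_mem_E {e : S} (he : e ∈ E S) : e⁻¹ = e := by
  have he' : e * e = e := he
  exact (inv_unique e e (by rw [he', he']) (by rw [he', he'])).symm

theorem inv_inv_eq (a : S) : a⁻¹⁻¹ = a :=
  (inv_unique a⁻¹ a (inv_mul_inv a) (mul_inv_mul a)).symm

theorem mul_inv_mem_E (a : S) : a * a⁻¹ ∈ E S := by
  change a * a⁻¹ * (a * a⁻¹) = a * a⁻¹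
  rw [← mul_assoc, mul_inv_mul]

theorem mul_mem_E {e f : S} (he : e ∈ E S) (hf : f ∈ E S) : e * f ∈ E S := by
  have he' : e * e = e := he
  have hf' : f * f = f := hf
  have h1 := mul_inv_mul (e * f)
  have h2 := inv_mul_inv (e * f)
  set x := (e * f)⁻¹ with hx
  have h2' : f * x * e * (f * x * e) = f * x * e := by
    calc f * x * e * (f * x * e) = f * (x * (e * f) * x) * e := by simp only [mul_assoc]
      _ = f * x * e := by rw [h2]
  have hg : f * x * e = x := by
    refine inv_unique (e * f) _ ?_ ?_
    · calc e * f * (f * x * e) * (e * f) = e * (f * f) * x * (e * e) * f := by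
            simp only [mul_assoc]
        _ = e * f * x * (e * f) := by rw [he', hf']; simp only [mul_assoc]
        _ = e * f := h1
    · calc f * x * e * (e * f) * (f * x * e) = f * x * (e * e) * (f * f) * x * e := by
            simp only [mul_assoc]
        _ = f * x * e * (f * x * e) := by rw [he', hf']; simp only [mul_assoc]
        _ = f * x * e := h2'
  have hxE : x ∈ E S := by
    rw [hg] at h2'
    exact h2'
  have : e * f = x := by
    rw [← inv_inv_eq (e * f), ← hx, inv_eq_self_of_mem_E hxE]
  rwa [this]

theorem mul_comm_of_mem_E {e f : S} (he : e ∈ E S) (hf : f ∈ E S) : e * f = f * e := by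
  have he' : e * e = e := he
  have hf' : f * f = f := hf
  have key : ∀ {a b : S}, a ∈ E S → b ∈ E S → a * b * (b * a) * (a * b) = a * b := by
    intro a b ha hb
    have ha' : a * a = a := ha
    have hb' : b * b = b := hb
    have hab : a * b * (a * b) = a * b := mul_mem_E ha hb
    calc a * b * (b * a) * (a * b) = a * (b * b) * (a * a) * b := by simp only [mul_assoc]
      _ = a * b * (a * b) := by rw [ha', hb']; simp only [mul_assoc]
      _ = a * b := hab
  have h := inv_unique (e * f) (f * e) (key he hf) (key hf he)
  rw [h, inv_eq_self_of_mem_E (mul_mem_E he hf)]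

theorem sle_iff_of_mem_E {e a : S} (he : e ∈ E S) : sle e a ↔ e = e * a := by
  have he' : e * e = e := he
  rw [sle, inv_eq_self_of_mem_E he, he']

theorem mem_E_of_sle {a e : S} (he : e ∈ E S) (h : sle a e) : a ∈ E S := by
  rw [h]
  exact mul_mem_E (mul_inv_mem_E a) he

theorem mul_eq_of_sle {c s t : S} (hc : c ∈ E S) (hcs : sle c s) (hts : sle t s) :
    c * t = t * t⁻¹ * c := by
  have hcs' := (sle_iff_of_mem_E hc).1 hcs
  calc c * t = c * (t * t⁻¹) * s := by rw [mul_assoc c, ← hts]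
    _ = t * t⁻¹ * (c * s) := by
      rw [mul_comm_of_mem_E hc (mul_inv_mem_E t), mul_assoc (t * t⁻¹)]
    _ = t * t⁻¹ * c := by rw [← hcs']

theorem mul_mem_E_of_sle {c s t : S} (hc : c ∈ E S) (hcs : sle c s) (hts : sle t s) :
    c * t ∈ E S := by
  rw [mul_eq_of_sle hc hcs hts]
  exact mul_mem_E (mul_inv_mem_E t) hc

theorem mul_sle_left {c s t : S} (hc : c ∈ E S) (hcs : sle c s) (hts : sle t s) :
    sle (c * t) c := by
  have hc' : c * c = c := hc
  rw [sle_iff_of_mem_E (mul_mem_E_of_sle hc hcs hts), mul_eq_of_sle hc hcs hts, mul_assoc _ c c, hc']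

theorem mul_sle_right {c s t : S} (hc : c ∈ E S) (hcs : sle c s) (hts : sle t s) :
    sle (c * t) t := by
  rw [sle_iff_of_mem_E (mul_mem_E_of_sle hc hcs hts)]
  calc c * t = c * (t * t⁻¹ * t) := by rw [mul_inv_mul]
    _ = c * (t * t⁻¹) * t := by simp only [mul_assoc]
    _ = t * t⁻¹ * c * t := by rw [mul_comm_of_mem_E hc (mul_inv_mem_E t)]
    _ = c * t * t := by rw [mul_eq_of_sle hc hcs hts]

theorem IsFilt.mem_of_sle {F : Set S} (hF : IsFilt F) {a b : S} (ha : a ∈ F) (h : sle a b) :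
    b ∈ F := by
  rw [← hF.2.1]
  exact ⟨a, ha, h⟩

/-- In a filter containing an idempotent `c ≤ s`, an element `t ≤ s` can be replaced by `c * t`. -/
theorem IsFilt.mul_mem_iff {F : Set S} (hF : IsFilt F) {c s t : S} (hc : c ∈ E S)
    (hcs : sle c s) (hts : sle t s) (hcF : c ∈ F) : c * t ∈ F ↔ t ∈ F := by
  refine ⟨fun h => hF.mem_of_sle h (mul_sle_right hc hcs hts), fun h => ?_⟩
  obtain ⟨d, hd, hdc, hdt⟩ := hF.2.2 c hcF t h
  have hdE := mem_E_of_sle hc hdc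
  refine hF.mem_of_sle hd ((sle_iff_of_mem_E hdE).2 ?_)
  rw [← mul_assoc, ← (sle_iff_of_mem_E hdE).1 hdc, ← (sle_iff_of_mem_E hdE).1 hdt]

theorem IsFilt.inter_image_mul_eq_empty_iff {F : Set S} (hF : IsFilt F) {c s : S} {T : Set S}
    (hc : c ∈ E S) (hcs : sle c s) (hT : T ⊆ dwn s) (hcF : c ∈ F) :
    F ∩ (c * ·) '' T = ∅ ↔ F ∩ T = ∅ := by
  simp only [Set.eq_empty_iff_forall_notMem, Set.mem_inter_iff, Set.mem_image, not_and]
  refine ⟨fun h t ht htT => h _ ((hF.mul_mem_iff hc hcs (hT htT) hcF).2 ht) ⟨t, htT, rfl⟩, ?_⟩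
  rintro h _ hx ⟨t, htT, rfl⟩
  exact h t ((hF.mul_mem_iff hc hcs (hT htT) hcF).1 hx) htT

theorem image_mul_subset_dwn {c s : S} {T : Set S} (hc : c ∈ E S) (hcs : sle c s)
    (hT : T ⊆ dwn s) : (c * ·) '' T ⊆ dwn c := by
  rintro _ ⟨t, ht, rfl⟩
  exact mul_sle_left hc hcs (hT ht)

/-- Every patch-open set contains, around each idempotent filter `F` in it, the idempotent proper
filters of some `F(e;X)` with `e` idempotent. -/
theorem exists_idempotent_nhd {U : Set (PFilt S)} (hU : IsOpen U) (F : IPFilt S)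
    (hF : (⟨F.1, F.2.1⟩ : PFilt S) ∈ U) :
    ∃ (e : S) (X : Set S), e ∈ E S ∧ X.Finite ∧ X ⊆ dwn e ∧ e ∈ F.1 ∧ F.1 ∩ X = ∅ ∧
      ∀ G : PFilt S, e ∈ G.1 → G.1 ∩ X = ∅ → G ∈ U := by
  induction hU with
  | basic U hU =>
    obtain ⟨s, T, hTfin, hT, rfl⟩ := hU
    obtain ⟨hsF, hFT⟩ := hF
    obtain ⟨f, hfF, hf⟩ := F.2.2
    obtain ⟨c, hcF, hcs, hcf⟩ := F.2.1.1.2.2 s hsF f hfF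
    have hc := mem_E_of_sle hf hcf
    refine ⟨c, (c * ·) '' T, hc, hTfin.image _, image_mul_subset_dwn hc hcs hT, hcF,
      (F.2.1.1.inter_image_mul_eq_empty_iff hc hcs hT hcF).2 hFT, fun G hcG hG => ?_⟩
    exact ⟨G.2.1.mem_of_sle hcG hcs, (G.2.1.inter_image_mul_eq_empty_iff hc hcs hT hcG).1 hG⟩
  | univ =>
    obtain ⟨f, hfF, hf⟩ := F.2.2
    exact ⟨f, ∅, hf, Set.finite_empty, Set.empty_subset _, hfF, Set.inter_empty _,
      fun _ _ _ => trivial⟩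
  | inter U V _ _ ihU ihV =>
    obtain ⟨e, X, he, hXfin, hX, heF, hFX, hXU⟩ := ihU hF.1
    obtain ⟨f, Y, hf, hYfin, hY, hfF, hFY, hYV⟩ := ihV hF.2
    obtain ⟨c, hcF, hce, hcf⟩ := F.2.1.1.2.2 e heF f hfF
    have hc := mem_E_of_sle he hce
    refine ⟨c, (c * ·) '' X ∪ (c * ·) '' Y, hc, (hXfin.image _).union (hYfin.image _),
      Set.union_subset (image_mul_subset_dwn hc hce hX) (image_mul_subset_dwn hc hcf hY), hcF,
      ?_, fun G hcG hG => ?_⟩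
    · rw [Set.inter_union_distrib_left, Set.union_empty_iff]
      exact ⟨(F.2.1.1.inter_image_mul_eq_empty_iff hc hce hX hcF).2 hFX,
        (F.2.1.1.inter_image_mul_eq_empty_iff hc hcf hY hcF).2 hFY⟩
    · rw [Set.inter_union_distrib_left, Set.union_empty_iff] at hG
      exact ⟨hXU G (G.2.1.mem_of_sle hcG hce)
          ((G.2.1.inter_image_mul_eq_empty_iff hc hce hX hcG).1 hG.1),
        hYV G (G.2.1.mem_of_sle hcG hcf)
          ((G.2.1.inter_image_mul_eq_empty_iff hc hcf hY hcG).1 hG.2)⟩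
  | sUnion 𝒰 _ ih =>
    obtain ⟨U, hU, hFU⟩ := hF
    obtain ⟨e, X, he, hXfin, hX, heF, hFX, hXU⟩ := ih U hU hFU
    exact ⟨e, X, he, hXfin, hX, heF, hFX, fun G h1 h2 => ⟨U, hU, hXU G h1 h2⟩⟩

end InvSemigroupWithZero

/-- The collection of sets `F(e;X)`, for `e` an idempotent and `X` a finite
subset of `↓e`, is a topological basis for the subspace topology induced by the patch
topology on the set of idempotent proper filters. -/
theorem stmt_0 {S : Type*} [InvSemigroupWithZero S] :
    TopologicalSpace.IsTopologicalBasis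
      {B : Set (IPFilt S) | ∃ (e : S) (X : Set S), e ∈ E S ∧ X.Finite ∧ X ⊆ dwn e ∧
        B = {F : IPFilt S | e ∈ F.1 ∧ F.1 ∩ X = ∅}} := by
  refine TopologicalSpace.isTopologicalBasis_of_isOpen_of_nhds ?_ ?_
  · rintro _ ⟨e, X, -, hXfin, hX, rfl⟩
    exact ⟨{F : PFilt S | e ∈ F.1 ∧ F.1 ∩ X = ∅},
      TopologicalSpace.isOpen_generateFrom_of_mem ⟨e, X, hXfin, hX, rfl⟩, rfl⟩
  · rintro F _ hF ⟨U, hU, rfl⟩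
    obtain ⟨e, X, he, hXfin, hX, heF, hFX, hXU⟩ := exists_idempotent_nhd hU F hF
    exact ⟨_, ⟨e, X, he, hXfin, hX, rfl⟩, ⟨heF, hFX⟩, fun G hG => hXU ⟨G.1, G.2.1⟩ hG.1 hG.2⟩
end

section
/- The set of idempotent proper filters of S, endowed with the subspace topology induced by the patch topology on the set of proper filters of S, is a Hausdorff topological space. -/
open InvSemigroupWithZero

namespace InvSemigroupWithZero

section Idempotents

variable {S : Type*} [InvSemigroupWithZero S]

theorem mul_self_mul_of_idem {e : S} (he : e * e = e) (z : S) : e * (e * z) = e * z := by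
  rw [← mul_assoc, he]

theorem inv_eq_self_of_idem {e : S} (he : e * e = e) : e⁻¹ = e :=
  (inv_unique e e (by rw [he, he]) (by rw [he, he])).symm

theorem idem_mul_idem {e f : S} (he : e * e = e) (hf : f * f = f) :
    e * f * (e * f) = e * f := by
  have h1 : e * f * (e * f)⁻¹ * (e * f) = e * f := mul_inv_mul (e * f)
  have h2 : (e * f)⁻¹ * (e * f) * (e * f)⁻¹ = (e * f)⁻¹ := inv_mul_inv (e * f)
  have h3 := inv_unique (e * f)⁻¹ (e * f) h2 h1
  generalize (e * f)⁻¹ = x at h1 h2 h3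
  have h4 : f * x * e = x := by
    have hx : x = (e * f)⁻¹ := inv_unique (e * f) x h1 h2
    rw [hx]
    refine inv_unique (e * f) _ ?_ ?_ <;> rw [← hx]
    · simpa only [mul_assoc, mul_self_mul_of_idem he, mul_self_mul_of_idem hf] using h1
    · simpa only [mul_assoc, mul_self_mul_of_idem he, mul_self_mul_of_idem hf] using
        congrArg (fun y => f * y * e) h2
  have h5 : x * x = x := by
    calc x * x = f * x * e * (f * x * e) := by rw [h4]
      _ = f * (x * (e * f) * x) * e := by simp only [mul_assoc]
      _ = x := by rw [h2, h4]
  rw [h3, inv_eq_self_of_idem h5, h5]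

theorem idem_comm {e f : S} (he : e * e = e) (hf : f * f = f) : e * f = f * e := by
  have h1 := idem_mul_idem he hf
  have h2 := idem_mul_idem hf he
  rw [← inv_eq_self_of_idem h1]
  refine (inv_unique (e * f) (f * e) ?_ ?_).symm
  · simpa only [mul_assoc, mul_self_mul_of_idem he, mul_self_mul_of_idem hf] using h1
  · simpa only [mul_assoc, mul_self_mul_of_idem he, mul_self_mul_of_idem hf] using h2

theorem mul_inv_idem (a : S) : a * a⁻¹ * (a * a⁻¹) = a * a⁻¹ := by
  rw [← mul_assoc, mul_inv_mul]

theorem idem_of_sle {d e : S} (he : e * e = e) (h : sle d e) : d * d = d := by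
  have h' := idem_mul_idem (mul_inv_idem d) he
  rwa [← show d = d * d⁻¹ * e from h] at h'

theorem sle_iff_of_idem {d e : S} (hd : d * d = d) : sle d e ↔ d * e = d := by
  rw [sle, inv_eq_self_of_idem hd, hd, eq_comm]

theorem idem_mul_sle_left {e f : S} (he : e * e = e) (hf : f * f = f) : sle (e * f) e := by
  rw [sle_iff_of_idem (idem_mul_idem he hf), idem_comm he hf, mul_assoc, he]

theorem idem_mul_sle_right {e f : S} (he : e * e = e) (hf : f * f = f) : sle (e * f) f := by
  rw [sle_iff_of_idem (idem_mul_idem he hf), mul_assoc, hf]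

theorem IsFilt.idem_mul_mem {F : Set S} (hF : IsFilt F) {e f : S} (he : e * e = e)
    (heF : e ∈ F) (hfF : f ∈ F) : e * f ∈ F := by
  obtain ⟨d, hd, hde, hdf⟩ := hF.2.2 e heF f hfF
  have hdd := idem_of_sle he hde
  refine hF.mem_of_sle hd ((sle_iff_of_idem hdd).2 ?_)
  rw [← mul_assoc, (sle_iff_of_idem hdd).1 hde, (sle_iff_of_idem hdd).1 hdf]

theorem isOpen_patch (s : S) {T : Set S} (hT : T.Finite) (hTs : T ⊆ dwn s) :
    IsOpen {F : IPFilt S | s ∈ F.1 ∧ F.1 ∩ T = ∅} :=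
  isOpen_induced_iff.2 ⟨{F : PFilt S | s ∈ F.1 ∧ F.1 ∩ T = ∅},
    TopologicalSpace.isOpen_generateFrom_of_mem ⟨s, T, hT, hTs, rfl⟩, rfl⟩

theorem exists_disjoint_open_of_not_subset {F G : IPFilt S} (h : ¬ F.1 ⊆ G.1) :
    ∃ U V : Set (IPFilt S), IsOpen U ∧ IsOpen V ∧ F ∈ U ∧ G ∈ V ∧ Disjoint U V := by
  obtain ⟨a, haF, haG⟩ := Set.not_subset.1 h
  obtain ⟨e, heF, he⟩ := F.2.2
  obtain ⟨g, hgG, hg⟩ := G.2.2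
  obtain ⟨c, hcF, hca, hce⟩ := F.2.1.1.2.2 a haF e heF
  have hc : c * c = c := idem_of_sle he hce
  have hcgG : c * g ∉ G.1 := fun hcg =>
    haG (G.2.1.1.mem_of_sle (G.2.1.1.mem_of_sle hcg (idem_mul_sle_left hc hg)) hca)
  refine ⟨_, _, isOpen_patch c Set.finite_empty (Set.empty_subset _),
    isOpen_patch g (Set.finite_singleton (c * g))
      (Set.singleton_subset_iff.2 (idem_mul_sle_right hc hg)),
    ⟨hcF, Set.inter_empty _⟩, ⟨hgG, Set.inter_singleton_eq_empty.2 hcgG⟩, ?_⟩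
  rw [Set.disjoint_left]
  rintro H ⟨hcH, -⟩ ⟨hgH, hH⟩
  exact Set.inter_singleton_eq_empty.1 hH (H.2.1.1.idem_mul_mem hc hcH hgH)

end Idempotents

end InvSemigroupWithZero

/-- The set of idempotent proper filters, with the subspace topology induced
by the patch topology on proper filters, is Hausdorff. -/
theorem stmt_3 {S : Type*} [InvSemigroupWithZero S] : T2Space (IPFilt S) := by
  refine ⟨fun F G hFG => ?_⟩
  by_cases h : F.1 ⊆ G.1
  · have h' : ¬ G.1 ⊆ F.1 := fun hGF => hFG (Subtype.ext (h.antisymm hGF))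
    obtain ⟨U, V, hU, hV, hGU, hFV, hUV⟩ := exists_disjoint_open_of_not_subset h'
    exact ⟨V, U, hV, hU, hFV, hGU, hUV.symm⟩
  · exact exists_disjoint_open_of_not_subset h
end
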